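/- arXiv:2010.02444 — 4 statements merged into one kernel-verified Lean document; each statement's English description precedes it below -/
import Mathlib

section
/- Let k ≥ 1 and n ≥ 1 be integers, σ > 0, Δ > 0, and let x, x̂ ∈ ℝⁿ be fixed vectors with prediction error ε = ‖x − x̂‖₂ > 0. Let a be a random vector in ℝⁿ with i.i.d. N(0,σ²) entries and let w be a random variable uniform on [−1,0), independent of a. Set y = (1/Δ)⟨a,x⟩ + w, ŷ = (1/Δ)⟨a,x̂⟩ + w, q = ⌊y + 1/2⌋, and define the predicted quantization index q̂ = q + 2^{k−1}·⌊(ŷ − q)/2^{k−1} + 1/2⌋ (the index congruent to q modulo 2^{k−1} whose quantization-interval center is closest to ŷ). Then the probability that q̂ ≢ q (mod 2^k), i.e., that the k-th least significant bit of the quantized measurement is predicted in error, equals p_k = 1/2 − Σ_{l=1}^{∞} exp(−(1/2)(πσεl/(2^{k−1}Δ))²) · sinc(l/2^k) · sinc(l/2). -/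
open MeasureTheory ProbabilityTheory Real Set

/-- The normalized sinc function: `sinc u = sin (π u) / (π u)` for `u ≠ 0`, `sinc 0 = 1`. -/
noncomputable def sinc (u : ℝ) : ℝ := if u = 0 then 1 else Real.sin (Real.pi * u) / (Real.pi * u)

/-- The `1`-periodic extension of the second Bernoulli polynomial `x² - x + 1/6` on `[0, 1)`. -/
noncomputable def periodicBernoulliTwo (x : ℝ) : ℝ := Int.fract x ^ 2 - Int.fract x + 1 / 6

lemma hasSum_cos_div_sq (x : ℝ) :
    HasSum (fun l : ℕ => Real.cos (2 * π * (l + 1) * x) / ((l : ℝ) + 1) ^ 2)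
      (π ^ 2 * periodicBernoulliTwo x) := by
  have h := hasSum_one_div_nat_pow_mul_cos (k := 1) one_ne_zero (x := Int.fract x)
    ⟨Int.fract_nonneg x, (Int.fract_lt_one x).le⟩
  rw [← hasSum_nat_add_iff' 1] at h
  convert! h using 1
  · funext l
    have : 2 * π * ((l : ℝ) + 1) * x
        = 2 * π * ((l : ℝ) + 1) * Int.fract x + ((l + 1) * ⌊x⌋ : ℤ) * (2 * π) := by
      push_cast
      rw [Int.fract]
      ring
    rw [this, Real.cos_add_int_mul_two_pi]
    push_cast
    ring
  · simp [Polynomial.bernoulli, Finset.sum_range_succ, periodicBernoulliTwo, bernoulli_two,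
      bernoulli_one]
    norm_num [Nat.factorial, Nat.choose]
    ring

lemma periodicBernoulliTwo_neg (x : ℝ) :
    periodicBernoulliTwo (-x) = periodicBernoulliTwo x := by
  unfold periodicBernoulliTwo
  by_cases hx : Int.fract x = 0
  · rw [hx, Int.fract_neg_eq_zero.2 hx]
  · rw [Int.fract_neg hx]
    ring

lemma continuous_periodicBernoulliTwo : Continuous periodicBernoulliTwo :=
  ContinuousOn.comp_fract'' (f := fun x : ℝ => x ^ 2 - x + 1 / 6) (by fun_prop) (by norm_num)

lemma hasDerivWithinAt_periodicBernoulliTwo (x : ℝ) :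
    HasDerivWithinAt periodicBernoulliTwo (2 * Int.fract x - 1) (Ici x) x := by
  have h : HasDerivWithinAt (fun y : ℝ => (y - ⌊x⌋) ^ 2 - (y - ⌊x⌋) + 1 / 6)
      (2 * Int.fract x - 1) (Ici x) x := by
    have h1 : HasDerivAt (fun y : ℝ => y - ⌊x⌋) 1 x := (hasDerivAt_id x).sub_const _
    have h2 := ((h1.pow 2).sub h1).add_const (1 / 6 : ℝ)
    refine HasDerivAt.hasDerivWithinAt ?_
    convert! h2 using 1
    push_cast [Int.fract]
    ring
  refine h.congr_of_eventuallyEq ?_ rfl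
  have : Ico x (⌊x⌋ + 1 : ℝ) ∈ nhdsWithin x (Ici x) :=
    Ico_mem_nhdsGE (Int.lt_floor_add_one x)
  filter_upwards [this] with y hy
  have hf : ⌊y⌋ = ⌊x⌋ := Int.floor_eq_iff.2 ⟨(Int.floor_le x).trans hy.1, hy.2⟩
  simp only [periodicBernoulliTwo, Int.fract, hf]

/-- An antiderivative of the centred square wave of period `2 * M`. -/
noncomputable def triangleWave (M v : ℝ) : ℝ :=
  M * (periodicBernoulliTwo (v / (2 * M) - 1 / 4) - periodicBernoulliTwo (v / (2 * M) + 1 / 4))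

lemma hasSum_sinc_mul_sinc_mul_cos {M : ℝ} (hM : 0 < M) (d : ℝ) :
    HasSum (fun l : ℕ => _root_.sinc (((l : ℝ) + 1) / (2 * M)) * _root_.sinc (((l : ℝ) + 1) / 2) *
        Real.cos (π * (l + 1) / M * d))
      (triangleWave M (d + 1 / 2) - triangleWave M (d - 1 / 2)) := by
  have h := (((hasSum_cos_div_sq (1 / 4 - 1 / (4 * M) + d / (2 * M))).add
    (hasSum_cos_div_sq (1 / 4 - 1 / (4 * M) - d / (2 * M)))).sub
    ((hasSum_cos_div_sq (1 / 4 + 1 / (4 * M) + d / (2 * M))).add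
    (hasSum_cos_div_sq (1 / 4 + 1 / (4 * M) - d / (2 * M))))).mul_left (M / π ^ 2)
  convert! h using 1
  · funext l
    have hl : (l : ℝ) + 1 ≠ 0 := by positivity
    have h1 : ((l : ℝ) + 1) / (2 * M) ≠ 0 := by positivity
    have h2 : ((l : ℝ) + 1) / 2 ≠ 0 := by positivity
    simp only [_root_.sinc, h1, h2, if_false]
    set A := π * (((l : ℝ) + 1) / 2) with hA
    set B := π * (((l : ℝ) + 1) / (2 * M)) with hB
    set C := π * (l + 1) / M * d with hC
    have e1 : 2 * π * ((l : ℝ) + 1) * (1 / 4 - 1 / (4 * M) + d / (2 * M)) = A - B + C := by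
      rw [hA, hB, hC]; field_simp; ring
    have e2 : 2 * π * ((l : ℝ) + 1) * (1 / 4 - 1 / (4 * M) - d / (2 * M)) = A - B - C := by
      rw [hA, hB, hC]; field_simp; ring
    have e3 : 2 * π * ((l : ℝ) + 1) * (1 / 4 + 1 / (4 * M) + d / (2 * M)) = A + B + C := by
      rw [hA, hB, hC]; field_simp; ring
    have e4 : 2 * π * ((l : ℝ) + 1) * (1 / 4 + 1 / (4 * M) - d / (2 * M)) = A + B - C := by
      rw [hA, hB, hC]; field_simp; ring
    rw [e1, e2, e3, e4]
    have hAB : B * A = π ^ 2 * (l + 1) ^ 2 / (4 * M) := by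
      rw [hA, hB]; field_simp; ring
    rw [div_mul_div_comm, hAB, cos_add (A - B), cos_sub (A - B), cos_add (A + B), cos_sub (A + B),
      cos_add A, cos_sub A]
    field_simp
    ring
  · have e1 : (d + 1 / 2) / (2 * M) - 1 / 4 = -(1 / 4 - 1 / (4 * M) - d / (2 * M)) := by
      field_simp; ring
    have e2 : (d + 1 / 2) / (2 * M) + 1 / 4 = 1 / 4 + 1 / (4 * M) + d / (2 * M) := by
      field_simp; ring
    have e3 : (d - 1 / 2) / (2 * M) - 1 / 4 = -(1 / 4 + 1 / (4 * M) - d / (2 * M)) := by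
      field_simp; ring
    have e4 : (d - 1 / 2) / (2 * M) + 1 / 4 = 1 / 4 - 1 / (4 * M) + d / (2 * M) := by
      field_simp; ring
    rw [triangleWave, triangleWave, e1, e2, e3, e4, periodicBernoulliTwo_neg,
      periodicBernoulliTwo_neg]
    field_simp
    ring

lemma fract_sub_half_sub_fract (z : ℝ) :
    Int.fract (z - 1 / 2) - Int.fract z = if Odd ⌊2 * z⌋ then -(1 / 2) else 1 / 2 := by
  have h0 := Int.fract_nonneg z
  have h1 := Int.fract_lt_one z
  have hz := Int.floor_add_fract z
  rcases lt_or_ge (Int.fract z) (1 / 2) with h | h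
  · have e1 : Int.fract (z - 1 / 2) = Int.fract z + 1 / 2 :=
      Int.fract_eq_iff.2 ⟨by linarith, by linarith, ⌊z⌋ - 1, by push_cast; linarith⟩
    have e2 : ⌊2 * z⌋ = 2 * ⌊z⌋ :=
      Int.floor_eq_iff.2 ⟨by push_cast; linarith, by push_cast; linarith⟩
    rw [e1, e2, if_neg (by simp)]
    ring
  · have e1 : Int.fract (z - 1 / 2) = Int.fract z - 1 / 2 :=
      Int.fract_eq_iff.2 ⟨by linarith, by linarith, ⌊z⌋, by linarith⟩
    have e2 : ⌊2 * z⌋ = 2 * ⌊z⌋ + 1 :=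
      Int.floor_eq_iff.2 ⟨by push_cast; linarith, by push_cast; linarith⟩
    rw [e1, e2, if_pos (by simp)]
    ring

/-- The indicator of the reals whose nearest integer multiple of `M` is an odd multiple. -/
noncomputable def oddIndicator (M v : ℝ) : ℝ := if Odd ⌊v / M + 1 / 2⌋ then 1 else 0

lemma measurable_oddIndicator (M : ℝ) : Measurable (oddIndicator M) := by
  refine Measurable.ite ?_ measurable_const measurable_const
  exact (Int.measurable_floor.comp (by fun_prop : Measurable fun v : ℝ => v / M + 1 / 2))
    (MeasurableSet.of_discrete (s := {m : ℤ | Odd m}))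

lemma oddIndicator_mem_Icc (M v : ℝ) : oddIndicator M v ∈ Icc (0 : ℝ) 1 := by
  unfold oddIndicator
  split_ifs <;> simp

lemma intervalIntegrable_oddIndicator (M a b : ℝ) :
    IntervalIntegrable (oddIndicator M) volume a b := by
  refine (intervalIntegrable_const (c := (1 : ℝ))).mono_fun
    (measurable_oddIndicator M).aestronglyMeasurable (ae_of_all _ fun v => ?_)
  have h := oddIndicator_mem_Icc M v
  simpa [abs_of_nonneg h.1] using h.2

lemma hasDerivWithinAt_triangleWave {M : ℝ} (hM : 0 < M) (v : ℝ) :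
    HasDerivWithinAt (triangleWave M) (1 / 2 - oddIndicator M v) (Ici v) v := by
  have key (c : ℝ) : HasDerivWithinAt (fun v => periodicBernoulliTwo (v / (2 * M) + c))
      ((2 * Int.fract (v / (2 * M) + c) - 1) * (1 / (2 * M))) (Ici v) v := by
    have h1 : HasDerivWithinAt (fun v : ℝ => v / (2 * M) + c) (1 / (2 * M)) (Ici v) v :=
      (((hasDerivAt_id v).div_const _).add_const c).hasDerivWithinAt
    refine (hasDerivWithinAt_periodicBernoulliTwo _).comp v h1 fun u hu => ?_
    have : v ≤ u := hu
    simp only [mem_Ici]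
    gcongr
  have h := ((key (-(1 / 4))).sub (key (1 / 4))).const_mul M
  have hf := fract_sub_half_sub_fract (v / (2 * M) + 1 / 4)
  have e1 : 2 * (v / (2 * M) + 1 / 4) = v / M + 1 / 2 := by field_simp; ring
  have e2 : v / (2 * M) + 1 / 4 - 1 / 2 = v / (2 * M) + -(1 / 4) := by ring
  rw [e1, e2] at hf
  convert! h using 1
  have e3 : M * ((2 * Int.fract (v / (2 * M) + -(1 / 4)) - 1) * (1 / (2 * M)) -
      (2 * Int.fract (v / (2 * M) + 1 / 4) - 1) * (1 / (2 * M)))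
      = Int.fract (v / (2 * M) + -(1 / 4)) - Int.fract (v / (2 * M) + 1 / 4) := by
    field_simp; ring
  rw [e3, hf, oddIndicator]
  split_ifs <;> norm_num

lemma continuous_triangleWave (M : ℝ) : Continuous (triangleWave M) := by
  unfold triangleWave
  have := continuous_periodicBernoulliTwo
  fun_prop

lemma integral_oddIndicator {M : ℝ} (hM : 0 < M) (d : ℝ) :
    ∫ v in (d - 1 / 2)..(d + 1 / 2), oddIndicator M v =
      1 / 2 - (triangleWave M (d + 1 / 2) - triangleWave M (d - 1 / 2)) := by
  have hi := intervalIntegrable_oddIndicator M (d - 1 / 2) (d + 1 / 2)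
  have h := intervalIntegral.integral_eq_sub_of_hasDeriv_right
    (continuous_triangleWave M).continuousOn
    (fun v _ => (hasDerivWithinAt_triangleWave hM v).mono Ioi_subset_Ici_self)
    (intervalIntegrable_const.sub hi)
  rw [intervalIntegral.integral_sub intervalIntegrable_const hi] at h
  rw [← h]
  simp
  ring

lemma integral_comp_fract (F : ℝ → ℝ) (c : ℝ) :
    ∫ w in (-1 : ℝ)..0, F (Int.fract (c + w)) = ∫ u in (0 : ℝ)..1, F u := by
  have hp : Function.Periodic (fun w => F (Int.fract (c + w))) 1 := fun w => by
    simp only [← add_assoc, Int.fract_add_one]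
  have h := hp.intervalIntegral_add_eq (-1) (-c)
  rw [neg_add_cancel] at h
  rw [h, intervalIntegral.integral_comp_add_left (fun u => F (Int.fract u)) c, add_neg_cancel,
    add_neg_cancel_left, intervalIntegral.integral_of_le zero_le_one,
    intervalIntegral.integral_of_le zero_le_one, integral_Ioc_eq_integral_Ioo, integral_Ioc_eq_integral_Ioo]
  refine setIntegral_congr_fun measurableSet_Ioo fun u hu => ?_
  simp only [Int.fract_eq_self.2 ⟨hu.1.le, hu.2⟩]

/-- The average of the odd-cell indicator over one full period of the dither `w`. -/
lemma integral_oddIndicator_dither {M : ℝ} (hM : 0 < M) (c d : ℝ) :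
    ∫ w in (-1 : ℝ)..0, oddIndicator M (Int.fract (c + w) - 1 / 2 + d) =
      1 / 2 - (triangleWave M (d + 1 / 2) - triangleWave M (d - 1 / 2)) := by
  rw [integral_comp_fract (fun u => oddIndicator M (u - 1 / 2 + d)) c, ← integral_oddIndicator hM d]
  have h := intervalIntegral.integral_comp_add_right (oddIndicator M) (d - 1 / 2)
    (a := (0 : ℝ)) (b := 1)
  convert! h using 2
  · ext; ring_nf
  · ring
  · ring

lemma integral_cos_sum_gaussian {Ω : Type*} [MeasurableSpace Ω] {P : Measure Ω}
    [IsProbabilityMeasure P] {ι : Type*} [Fintype ι] {v : NNReal} {a : Ω → ι → ℝ}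
    (ha_meas : Measurable a) (ha_indep : iIndepFun (fun i ω => a ω i) P)
    (ha_law : ∀ i, Measure.map (fun ω => a ω i) P = gaussianReal 0 v) (c : ι → ℝ) (t : ℝ) :
    ∫ ω, Real.cos (t * ∑ i, c i * a ω i) ∂P =
      Real.exp (-(1 / 2) * (v * t ^ 2 * ∑ i, c i ^ 2)) := by
  have hm (i : ι) : Measurable fun ω => a ω i := (measurable_pi_apply i).comp ha_meas
  have hind : iIndepFun (fun i ω => c i * a ω i) P :=
    ha_indep.comp (fun i u => c i * u) fun i => measurable_const_mul (c i)
  have hS : Measurable fun ω => ∑ i, c i * a ω i :=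
    Finset.measurable_sum _ fun i _ => (hm i).const_mul (c i)
  have h1 : charFun (P.map fun ω => ∑ i, c i * a ω i) t =
      ((Real.exp (-(1 / 2) * (v * t ^ 2 * ∑ i, c i ^ 2)) : ℝ) : ℂ) := by
    rw [hind.charFun_map_fun_sum_eq_prod fun i => ((hm i).const_mul (c i)).aemeasurable,
      Finset.prod_apply]
    have (i : ι) : charFun (P.map fun ω => c i * a ω i) t =
        Complex.exp (-(v * (c i * t) ^ 2 / 2)) := by
      rw [charFun_map_mul_comp (hm i).aemeasurable, ha_law i, charFun_gaussianReal]
      simp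
    simp only [this, ← Complex.exp_sum]
    push_cast
    congr 1
    simp only [Finset.mul_sum]
    exact Finset.sum_congr rfl fun i _ => by ring
  rw [charFun_apply_real, integral_map hS.aemeasurable (by fun_prop)] at h1
  have h2 := congrArg Complex.re h1
  rw [Complex.ofReal_re, ← RCLike.re_eq_complex_re, ← integral_re] at h2
  · rw [← h2]
    refine integral_congr_ae (ae_of_all _ fun ω => ?_)
    simp only [RCLike.re_eq_complex_re]
    rw [← Complex.ofReal_mul, Complex.exp_ofReal_mul_I_re]
  · refine Integrable.of_bound (C := 1) (by fun_prop) (ae_of_all _ fun ω => ?_)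
    rw [← Complex.ofReal_mul, Complex.norm_exp_ofReal_mul_I]

lemma integral_triangleWave_sub {Ω : Type*} [MeasurableSpace Ω] {P : Measure Ω}
    [IsProbabilityMeasure P] {M : ℝ} (hM : 0 < M) {D : Ω → ℝ} (hD : Measurable D) :
    ∫ ω, (triangleWave M (D ω + 1 / 2) - triangleWave M (D ω - 1 / 2)) ∂P =
      ∑' l : ℕ, _root_.sinc (((l : ℝ) + 1) / (2 * M)) * _root_.sinc (((l : ℝ) + 1) / 2) *
        ∫ ω, Real.cos (π * (l + 1) / M * D ω) ∂P := by
  have hint (l : ℕ) : Integrable (fun ω => Real.cos (π * (l + 1) / M * D ω)) P :=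
    Integrable.of_bound (C := 1) (by fun_prop) (ae_of_all _ fun ω => Real.abs_cos_le_one _)
  have hsum : Summable fun l : ℕ =>
      |_root_.sinc (((l : ℝ) + 1) / (2 * M)) * _root_.sinc (((l : ℝ) + 1) / 2)| := by
    simpa using (hasSum_sinc_mul_sinc_mul_cos hM 0).summable.abs
  have h := hasSum_integral_of_summable_integral_norm (μ := P)
    (fun l : ℕ => (hint l).const_mul
      (_root_.sinc (((l : ℝ) + 1) / (2 * M)) * _root_.sinc (((l : ℝ) + 1) / 2))) ?_
  · simp only [(hasSum_sinc_mul_sinc_mul_cos hM _).tsum_eq, integral_const_mul] at h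
    exact h.tsum_eq.symm
  · refine hsum.of_nonneg_of_le (fun l => integral_nonneg fun ω => norm_nonneg _) fun l => ?_
    simp only [norm_mul, integral_const_mul, Real.norm_eq_abs, abs_mul]
    refine mul_le_of_le_one_right (by positivity) ?_
    calc ∫ ω, |Real.cos (π * (l + 1) / M * D ω)| ∂P ≤ ∫ _, (1 : ℝ) ∂P :=
          integral_mono (hint l).abs (integrable_const _) fun ω => Real.abs_cos_le_one _
      _ = 1 := by simp

lemma integral_oddIndicator_comp {Ω : Type*} [MeasurableSpace Ω] {P : Measure Ω}
    [IsProbabilityMeasure P] {β : Type*} [MeasurableSpace β] {M : ℝ} (hM : 0 < M)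
    {a : Ω → β} {w : Ω → ℝ} (ha : Measurable a) (hw : Measurable w)
    (hw_law : Measure.map w P = volume.restrict (Set.Ico (-1 : ℝ) 0)) (h_indep : IndepFun a w P)
    {c d : β → ℝ} (hc : Measurable c) (hd : Measurable d) :
    ∫ ω, oddIndicator M (Int.fract (c (a ω) + w ω) - 1 / 2 + d (a ω)) ∂P =
      1 / 2 - ∫ ω, (triangleWave M (d (a ω) + 1 / 2) - triangleWave M (d (a ω) - 1 / 2)) ∂P := by
  set G : β × ℝ → ℝ := fun z => oddIndicator M (Int.fract (c z.1 + z.2) - 1 / 2 + d z.1) with hG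
  have hGm : Measurable G := (measurable_oddIndicator M).comp (by fun_prop)
  have hb (z : β × ℝ) : ‖G z‖ ≤ 1 := by
    have h := oddIndicator_mem_Icc M (Int.fract (c z.1 + z.2) - 1 / 2 + d z.1)
    rw [Real.norm_eq_abs, abs_of_nonneg h.1]
    exact h.2
  have := Measure.isProbabilityMeasure_map ha.aemeasurable (μ := P)
  have := Measure.isProbabilityMeasure_map hw.aemeasurable (μ := P)
  have hinner (b : β) : ∫ u, G (b, u) ∂(P.map w) =
      1 / 2 - (triangleWave M (d b + 1 / 2) - triangleWave M (d b - 1 / 2)) := by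
    rw [hw_law, integral_Ico_eq_integral_Ioo, ← integral_Ioc_eq_integral_Ioo,
      ← intervalIntegral.integral_of_le (by norm_num)]
    exact integral_oddIndicator_dither hM (c b) (d b)
  have hT : Measurable (triangleWave M) := (continuous_triangleWave M).measurable
  have hTi : Integrable
      (fun ω => triangleWave M (d (a ω) + 1 / 2) - triangleWave M (d (a ω) - 1 / 2)) P := by
    refine Integrable.of_bound (C := 1) (by fun_prop) (ae_of_all _ fun ω => ?_)
    have h1 := hinner (a ω)
    have h2 : 0 ≤ ∫ u, G (a ω, u) ∂(P.map w) :=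
      integral_nonneg fun u => (oddIndicator_mem_Icc M _).1
    have h3 : ∫ u, G (a ω, u) ∂(P.map w) ≤ 1 := by
      have := norm_integral_le_of_norm_le_const (μ := P.map w) (ae_of_all _ fun u => hb (a ω, u))
      simpa using (le_abs_self _).trans this
    rw [Real.norm_eq_abs, abs_le]
    constructor <;> linarith
  calc ∫ ω, oddIndicator M (Int.fract (c (a ω) + w ω) - 1 / 2 + d (a ω)) ∂P
      = ∫ z, G z ∂(P.map fun ω => (a ω, w ω)) :=
        (integral_map (ha.prodMk hw).aemeasurable hGm.aestronglyMeasurable).symm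
    _ = ∫ b, ∫ u, G (b, u) ∂(P.map w) ∂(P.map a) := by
        rw [h_indep.map_prod_eq_prod_map_map ha.aemeasurable hw.aemeasurable]
        exact integral_prod _ (Integrable.of_bound hGm.aestronglyMeasurable 1 (ae_of_all _ hb))
    _ = ∫ ω, (1 / 2 - (triangleWave M (d (a ω) + 1 / 2) - triangleWave M (d (a ω) - 1 / 2))) ∂P := by
        simp only [hinner]
        exact integral_map ha.aemeasurable (by fun_prop)
    _ = _ := by
        rw [integral_sub (integrable_const _) hTi]
        simp

lemma not_modEq_iff_odd (j : ℕ) (q m : ℤ) :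
    ¬ (q + 2 ^ j * m ≡ q [ZMOD (2 : ℤ) ^ (j + 1)]) ↔ Odd m := by
  rw [← Int.not_even_iff_odd, not_iff_not, Int.modEq_comm, Int.modEq_iff_dvd, add_sub_cancel_left,
    pow_succ, mul_dvd_mul_iff_left (by positivity), even_iff_two_dvd]

/-- **Theorem 1 of the paper.** The probability that the `k`-th least significant bit of the
quantized dithered Gaussian random projection is predicted in error equals
`p_k = 1/2 − Σ_{l≥1} exp(−(1/2)(πσεl/(2^{k−1}Δ))²) sinc(l/2^k) sinc(l/2)`. -/
theorem bit_error_probability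
    {Ω : Type*} [MeasurableSpace Ω] (P : Measure Ω) [IsProbabilityMeasure P]
    (k n : ℕ) (hk : 1 ≤ k) (hn : 1 ≤ n)
    (σ Δ : ℝ) (hσ : 0 < σ) (hΔ : 0 < Δ)
    (x xh : Fin n → ℝ)
    (ε : ℝ) (hε : ε = Real.sqrt (∑ i, (x i - xh i) ^ 2)) (hεpos : 0 < ε)
    (a : Ω → Fin n → ℝ) (w : Ω → ℝ)
    (ha_meas : Measurable a) (hw_meas : Measurable w)
    (ha_indep : iIndepFun (fun i ω => a ω i) P)
    (ha_law : ∀ i, Measure.map (fun ω => a ω i) P = gaussianReal 0 ⟨σ ^ 2, sq_nonneg σ⟩)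
    (hw_law : Measure.map w P = volume.restrict (Set.Ico (-1 : ℝ) 0))
    (haw_indep : IndepFun a w P)
    (y yh : Ω → ℝ)
    (hy : y = fun ω => (1 / Δ) * (∑ i, a ω i * x i) + w ω)
    (hyh : yh = fun ω => (1 / Δ) * (∑ i, a ω i * xh i) + w ω)
    (q qh : Ω → ℤ)
    (hq : q = fun ω => ⌊y ω + 1 / 2⌋)
    (hqh : qh = fun ω => q ω + 2 ^ (k - 1) * ⌊(yh ω - (q ω : ℝ)) / 2 ^ (k - 1) + 1 / 2⌋) :
    P {ω | ¬ (qh ω ≡ q ω [ZMOD ((2 : ℤ) ^ k)])} =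
      ENNReal.ofReal (1 / 2 - ∑' l : ℕ,
        Real.exp (-(1 / 2) * (Real.pi * σ * ε * (l + 1) / (2 ^ (k - 1) * Δ)) ^ 2) *
          _root_.sinc ((l + 1) / 2 ^ k) * _root_.sinc ((l + 1) / 2)) := by
  obtain ⟨j, rfl⟩ : ∃ j, k = j + 1 := ⟨k - 1, by omega⟩
  simp only [Nat.add_sub_cancel] at *
  obtain ⟨v, hv, ha_gauss⟩ : ∃ v : NNReal, (v : ℝ) = σ ^ 2 ∧
      ∀ i, Measure.map (fun ω => a ω i) P = gaussianReal 0 v := ⟨_, rfl, ha_law⟩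
  have hM : (0 : ℝ) < 2 ^ j := by positivity
  set c : (Fin n → ℝ) → ℝ := fun b => (1 / Δ) * (∑ i, b i * x i) + 1 / 2 with hc
  set d : (Fin n → ℝ) → ℝ := fun b => ∑ i, (xh i - x i) / Δ * b i with hd
  have hcm : Measurable c := by fun_prop
  have hdm : Measurable d := by fun_prop
  set X : Ω → ℝ := fun ω => Int.fract (c (a ω) + w ω) - 1 / 2 + d (a ω) with hX
  have hXm : Measurable X := by fun_prop
  have hset : {ω | ¬ (qh ω ≡ q ω [ZMOD ((2 : ℤ) ^ (j + 1))])} =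
      {ω | Odd ⌊X ω / 2 ^ j + 1 / 2⌋} := by
    ext ω
    have hXω : yh ω - q ω = X ω := by
      have hdω : d (a ω) = 1 / Δ * ∑ i, a ω i * xh i - 1 / Δ * ∑ i, a ω i * x i := by
        simp only [hd, Finset.mul_sum, ← Finset.sum_sub_distrib]
        exact Finset.sum_congr rfl fun i _ => by ring
      have hcω : c (a ω) + w ω = y ω + 1 / 2 := by
        simp only [hc, hy]
        ring
      simp only [hX]
      rw [hcω, hdω, Int.fract, hq, hyh, hy]
      ring
    have hqω : qh ω = q ω + 2 ^ j * ⌊X ω / 2 ^ j + 1 / 2⌋ := by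
      rw [← hXω, hqh]
    rw [mem_ofPred_eq, mem_ofPred_eq, hqω, not_modEq_iff_odd]
  have hms : MeasurableSet {ω | Odd ⌊X ω / 2 ^ j + 1 / 2⌋} :=
    (Int.measurable_floor.comp (by fun_prop : Measurable fun ω => X ω / 2 ^ j + 1 / 2))
      (MeasurableSet.of_discrete (s := {m : ℤ | Odd m}))
  have hreal : P.real {ω | Odd ⌊X ω / 2 ^ j + 1 / 2⌋} = ∫ ω, oddIndicator (2 ^ j) (X ω) ∂P := by
    rw [← integral_indicator_one hms]
    refine integral_congr_ae (ae_of_all _ fun ω => ?_)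
    simp [indicator_apply, oddIndicator]
  rw [hset, ← ofReal_measureReal, hreal,
    integral_oddIndicator_comp hM ha_meas hw_meas hw_law haw_indep hcm hdm,
    integral_triangleWave_sub hM (D := fun ω => d (a ω)) (hdm.comp ha_meas)]
  congr 3
  funext l
  rw [integral_cos_sum_gaussian ha_meas ha_indep ha_gauss]
  have hε2 : ∑ i, ((xh i - x i) / Δ) ^ 2 = ε ^ 2 / Δ ^ 2 := by
    rw [hε, Real.sq_sqrt (Finset.sum_nonneg fun i _ => sq_nonneg _), Finset.sum_div]
    exact Finset.sum_congr rfl fun i _ => by ring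
  have hexp : -(1 / 2) * (v * (π * (l + 1) / 2 ^ j) ^ 2 *
      ∑ i, ((xh i - x i) / Δ) ^ 2) = -(1 / 2) * (π * σ * ε * (l + 1) / (2 ^ j * Δ)) ^ 2 := by
    rw [hε2, hv]
    field_simp
  rw [hexp, pow_succ' (2 : ℝ) j]
  ring
end

section
/- Let k ≥ 1 be an integer, s > 0, c ∈ ℝ, and let D be a random variable with distribution N(0,s²). Then A₁(k,c) := P( D ∈ ⋃_{l∈ℤ} [c + l·2^k − 1/2, c + l·2^k + 1/2] ) = (1/2^k)·( 1 + 2·Σ_{l=1}^{∞} exp(−(1/2)(πsl/2^{k−1})²) · cos(πcl/2^{k−1}) · sinc(l/2^k) ). -/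
open MeasureTheory ProbabilityTheory Real Set

theorem summable_exp_neg_mul_int_sq {b : ℝ} (hb : 0 < b) :
    Summable fun n : ℤ ↦ rexp (-b * n ^ 2) := by
  have h := ((summable_jacobiTheta₂_term_iff 0 (Complex.I * (b / π : ℝ))).2
    (by rw [Complex.I_mul_im, Complex.ofReal_re]; positivity)).norm
  refine h.congr fun n ↦ ?_
  rw [norm_jacobiTheta₂_term, Complex.I_mul_im, Complex.ofReal_re]
  congr 1
  simp
  field_simp

theorem summable_gaussianPDFReal_add_int_mul {v : NNReal} {s T : ℝ}
    (hv : (v : ℝ) = s ^ 2) (hs : 0 < s) (hT : 0 < T) (x : ℝ) :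
    Summable fun n : ℤ ↦ gaussianPDFReal 0 v (x + n * T) := by
  simp only [gaussianPDFReal, hv, sub_zero]
  refine Summable.mul_left _ ?_
  refine Summable.of_nonneg_of_le (fun _ ↦ (exp_pos _).le) (fun n ↦ ?_)
    ((summable_exp_neg_mul_int_sq (b := T ^ 2 / (4 * s ^ 2)) (by positivity)).mul_left
      (rexp (x ^ 2 / (2 * s ^ 2))))
  rw [← Real.exp_add, exp_le_exp]
  have h : (0 : ℝ) ≤ (2 * x + n * T) ^ 2 / (4 * s ^ 2) := by positivity
  refine le_of_sub_nonneg (h.trans_eq ?_)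
  field_simp
  ring

theorem tsum_gaussianPDFReal_add_int_mul {v : NNReal} {s T : ℝ}
    (hv : (v : ℝ) = s ^ 2) (hs : 0 < s) (hT : 0 < T) (x : ℝ) :
    ∑' n : ℤ, gaussianPDFReal 0 v (x + n * T) =
      1 / T * (1 + 2 * ∑' l : ℕ, rexp (-(1 / 2) * (2 * π * s * (l + 1) / T) ^ 2) *
        cos (2 * π * (l + 1) / T * x)) := by
  set a : ℝ := 2 * π * s ^ 2 / T ^ 2 with ha
  have ha0 : 0 < a := by positivity
  set g : ℤ → ℝ := fun n ↦ rexp (-(π * a) * n ^ 2) * cos (2 * π * n / T * x) with hg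
  have hre : ∀ n : ℤ, (Complex.exp (-π * (a : ℂ) * n ^ 2
      + 2 * π * (((-(x / T) : ℝ) : ℂ) * Complex.I) * n)).re = g n := fun n ↦ by
    rw [show -π * (a : ℂ) * n ^ 2 + 2 * π * (((-(x / T) : ℝ) : ℂ) * Complex.I) * n =
      ((-(π * a) * n ^ 2 : ℝ) : ℂ) + ((-(2 * π * n / T * x) : ℝ) : ℂ) * Complex.I by
        push_cast; ring]
    rw [Complex.exp_add, ← Complex.ofReal_exp, Complex.re_ofReal_mul,
      Complex.exp_ofReal_mul_I_re, Real.cos_neg]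
  have hnorm : Summable fun n : ℤ ↦ Complex.exp (-π * (a : ℂ) * n ^ 2
      + 2 * π * (((-(x / T) : ℝ) : ℂ) * Complex.I) * n) := by
    refine Summable.of_norm ((summable_exp_neg_mul_int_sq (b := π * a) (by positivity)).congr
      fun n ↦ ?_)
    rw [show -π * (a : ℂ) * n ^ 2 + 2 * π * (((-(x / T) : ℝ) : ℂ) * Complex.I) * n =
      ((-(π * a) * n ^ 2 : ℝ) : ℂ) + ((-(2 * π * n / T * x) : ℝ) : ℂ) * Complex.I by
        push_cast; ring]
    rw [Complex.exp_add, norm_mul, Complex.norm_exp_ofReal_mul_I, mul_one, Complex.norm_exp,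
      Complex.ofReal_re]
  have hgs := Complex.hasSum_re hnorm.hasSum
  simp only [hre] at hgs
  have hP := Complex.tsum_exp_neg_quadratic (a := (a : ℂ)) (by simpa using ha0)
    (((-(x / T) : ℝ) : ℂ) * Complex.I)
  have hR : (1 / (a : ℂ) ^ (1 / 2 : ℂ) * ∑' n : ℤ, Complex.exp (-π / a * (n + Complex.I *
      (((-(x / T) : ℝ) : ℂ) * Complex.I)) ^ 2)) =
      ((T * ∑' n : ℤ, gaussianPDFReal 0 v (x + n * T) : ℝ) : ℂ) := by
    have h1 : (a : ℂ) ^ (1 / 2 : ℂ) = ((√a : ℝ) : ℂ) := by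
      rw [Real.sqrt_eq_rpow, Complex.ofReal_cpow ha0.le]; norm_num
    have h2 : √a = √(2 * π * s ^ 2) / T := by
      rw [ha, Real.sqrt_div (by positivity), Real.sqrt_sq hT.le]
    rw [h1, h2, ← tsum_mul_left, ← tsum_mul_left, Complex.ofReal_tsum]
    refine tsum_congr fun n ↦ ?_
    rw [show -π / (a : ℂ) * (n + Complex.I * (((-(x / T) : ℝ) : ℂ) * Complex.I)) ^ 2 =
      ((-(x + n * T) ^ 2 / (2 * s ^ 2) : ℝ) : ℂ) by
        have : Complex.I * (((-(x / T) : ℝ) : ℂ) * Complex.I) = ((x / T : ℝ) : ℂ) := by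
          rw [mul_left_comm, Complex.I_mul_I]; push_cast; ring
        rw [this, ha]
        norm_cast
        field_simp
        ring]
    simp only [gaussianPDFReal, hv, sub_zero]
    rw [← Complex.ofReal_exp]
    norm_cast
    field_simp
  rw [hP, hR, Complex.ofReal_re] at hgs
  have hgn := hgs.nat_add_neg
  have hg0 : g 0 = 1 := by simp [hg]
  have hgneg : ∀ n : ℕ, g n + g (-n) = 2 * g n := fun n ↦ by
    have : g (-n) = g n := by simp [hg, neg_div]
    rw [this, two_mul]
  simp only [hgneg, hg0] at hgn
  have hsum := (hasSum_nat_add_iff' 1).2 hgn |>.tsum_eq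
  simp only [Finset.sum_range_one, Nat.cast_zero, hg0] at hsum
  rw [tsum_mul_left] at hsum
  have : ∑' l : ℕ, rexp (-(1 / 2) * (2 * π * s * (l + 1) / T) ^ 2) *
        cos (2 * π * (l + 1) / T * x) = ∑' l : ℕ, g ((l + 1 : ℕ) : ℤ) := by
    refine tsum_congr fun l ↦ ?_
    simp only [hg, ha]
    push_cast
    congr 2
    field_simp
  rw [this, hsum]
  field_simp
  ring_nf

theorem integral_cos_mul_unit_interval {w : ℝ} (hw : w ≠ 0) (c : ℝ) :
    ∫ x in (c - 1 / 2)..(c + 1 / 2), cos (w * x) = cos (w * c) * (sin (w / 2) / (w / 2)) := by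
  rw [intervalIntegral.integral_comp_mul_left _ hw, integral_cos, smul_eq_mul,
    show w * (c + 1 / 2) = w * c + w / 2 by ring, show w * (c - 1 / 2) = w * c - w / 2 by ring,
    sin_add, sin_sub]
  field_simp
  ring

theorem gaussianReal_iUnion_Icc_eq_ofReal_intervalIntegral {v : NNReal} {s T : ℝ}
    (hv : (v : ℝ) = s ^ 2) (hs : 0 < s) (hT : 1 < T)
    (c : ℝ) {f : ℝ → ℝ} (hf : Continuous f)
    (hfs : ∀ x, ∑' n : ℤ, gaussianPDFReal 0 v (x + n * T) = f x) :
    gaussianReal 0 v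
      (⋃ n : ℤ, Icc (c + n * T - 1 / 2) (c + n * T + 1 / 2)) =
      ENNReal.ofReal (∫ x in (c - 1 / 2)..(c + 1 / 2), f x) := by
  have hv0 : v ≠ 0 := by
    rw [← NNReal.coe_ne_zero, hv]; exact (pow_pos hs 2).ne'
  have hT0 : 0 < T := by linarith
  have hdisj : Pairwise (Function.onFun Disjoint
      fun n : ℤ ↦ Icc (c + n * T - 1 / 2) (c + n * T + 1 / 2)) := by
    refine pairwise_disjoint_on _ |>.2 fun m n hmn ↦ Set.disjoint_left.2 fun x hx hx' ↦ ?_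
    have h : (m : ℝ) + 1 ≤ n := by exact_mod_cast hmn
    nlinarith [hx.2, hx'.1, mul_le_mul_of_nonneg_right h hT0.le]
  have hshift : ∀ n : ℤ, gaussianReal 0 v
      (Icc (c + n * T - 1 / 2) (c + n * T + 1 / 2)) =
      ∫⁻ x in Icc (c - 1 / 2) (c + 1 / 2), gaussianPDF 0 v (x + n * T) := by
    intro n
    rw [gaussianReal_apply _ hv0, ← (measurePreserving_add_right volume
      ((n : ℝ) * T)).setLIntegral_comp_preimage measurableSet_Icc (measurable_gaussianPDF _ _)]
    congr 2
    rw [Set.preimage_add_const_Icc]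
    ring_nf
  rw [measure_iUnion hdisj fun _ ↦ measurableSet_Icc]
  simp_rw [hshift]
  rw [← lintegral_tsum fun n ↦ by fun_prop]
  have hpt : ∀ x, ∑' n : ℤ, gaussianPDF 0 v (x + n * T) =
      ENNReal.ofReal (f x) := fun x ↦ by
    rw [← hfs x, ENNReal.ofReal_tsum_of_nonneg (fun _ ↦ gaussianPDFReal_nonneg _ _ _)
      (summable_gaussianPDFReal_add_int_mul hv hs hT0 x)]
    rfl
  simp_rw [hpt]
  rw [intervalIntegral.integral_of_le (by linarith), ← integral_Icc_eq_integral_Ioc,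
    ofReal_integral_eq_lintegral_ofReal hf.continuousOn.integrableOn_Icc]
  exact ae_of_all _ fun x ↦ (hfs x).symm ▸ tsum_nonneg fun _ ↦ gaussianPDFReal_nonneg _ _ _

/-- For `D ~ N(0,s²)`, the probability that `D` lands in the `2^k`-periodic union of unit-width
intervals with offset `c` equals
`A₁(k,c) = (1/2^k)(1 + 2 Σ_{l≥1} exp(−(1/2)(πsl/2^{k−1})²) cos(πcl/2^{k−1}) sinc(l/2^k))`. -/
theorem gaussian_prob_periodic_intervals
    {Ω : Type*} [MeasurableSpace Ω] (P : Measure Ω) [IsProbabilityMeasure P]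
    (k : ℕ) (hk : 1 ≤ k) (s : ℝ) (hs : 0 < s) (c : ℝ)
    (D : Ω → ℝ) (hD_meas : Measurable D)
    (hD : Measure.map D P = gaussianReal 0 ⟨s ^ 2, sq_nonneg s⟩) :
    P {ω | ∃ l : ℤ, D ω ∈
        Set.Icc (c + (l : ℝ) * 2 ^ k - 1 / 2) (c + (l : ℝ) * 2 ^ k + 1 / 2)} =
      ENNReal.ofReal ((1 / 2 ^ k) * (1 + 2 * ∑' l : ℕ,
        Real.exp (-(1 / 2) * (Real.pi * s * (l + 1) / 2 ^ (k - 1)) ^ 2) *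
          Real.cos (Real.pi * c * (l + 1) / 2 ^ (k - 1)) * _root_.sinc ((l + 1) / 2 ^ k))) := by
  set T : ℝ := 2 ^ k with hT
  have hT1 : 1 < T := one_lt_pow₀ one_lt_two (by omega)
  have hT0 : 0 < T := by linarith
  have hk2 : (2 : ℝ) ^ (k - 1) = T / 2 := by
    rw [hT, pow_sub₀ _ two_ne_zero hk, pow_one, div_eq_mul_inv]
  set u : ℕ → ℝ := fun l ↦ rexp (-(1 / 2) * (2 * π * s * (l + 1) / T) ^ 2) with hu
  have hus : Summable u := by
    have h := (summable_exp_neg_mul_int_sq (b := 2 * π ^ 2 * s ^ 2 / T ^ 2)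
      (by positivity)).comp_injective (i := fun l : ℕ ↦ ((l + 1 : ℕ) : ℤ))
        (fun _ _ h ↦ by simpa using h)
    refine h.congr fun l ↦ ?_
    simp only [Function.comp_apply, hu]
    push_cast
    ring_nf
  have hbound : ∀ l x, ‖u l * cos (2 * π * (l + 1) / T * x)‖ ≤ u l := fun l x ↦ by
    rw [norm_mul, Real.norm_of_nonneg (exp_pos _).le]
    exact mul_le_of_le_one_right (exp_pos _).le (abs_cos_le_one _)
  have hcont : Continuous fun x ↦ ∑' l : ℕ, u l * cos (2 * π * (l + 1) / T * x) :=
    continuous_tsum (fun l ↦ by fun_prop) hus hbound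
  have hint := intervalIntegral.hasSum_integral_of_dominated_convergence
    (μ := volume) (a := c - 1 / 2) (b := c + 1 / 2)
    (F := fun l x ↦ u l * cos (2 * π * (l + 1) / T * x))
    (f := fun x ↦ ∑' l : ℕ, u l * cos (2 * π * (l + 1) / T * x))
    (fun l _ ↦ u l) (fun l ↦ (by fun_prop : Continuous _).aestronglyMeasurable)
    (fun l ↦ ae_of_all _ fun x _ ↦ hbound l x) (ae_of_all _ fun _ _ ↦ hus)
    intervalIntegrable_const
    (ae_of_all _ fun x _ ↦ (Summable.of_norm_bounded hus fun l ↦ hbound l x).hasSum)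
  have hset : {ω | ∃ l : ℤ, D ω ∈ Icc (c + (l : ℝ) * T - 1 / 2) (c + (l : ℝ) * T + 1 / 2)} =
      D ⁻¹' ⋃ n : ℤ, Icc (c + n * T - 1 / 2) (c + n * T + 1 / 2) := by
    ext; simp
  obtain ⟨v, hv, hDv⟩ : ∃ v : NNReal, (v : ℝ) = s ^ 2 ∧ Measure.map D P = gaussianReal 0 v :=
    ⟨_, rfl, hD⟩
  rw [hset, ← Measure.map_apply hD_meas (MeasurableSet.iUnion fun _ ↦ measurableSet_Icc), hDv,
    gaussianReal_iUnion_Icc_eq_ofReal_intervalIntegral hv hs hT1 c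
      (f := fun x ↦ 1 / T * (1 + 2 * ∑' l : ℕ, u l * cos (2 * π * (l + 1) / T * x)))
      (by fun_prop) (tsum_gaussianPDFReal_add_int_mul hv hs hT0),
    intervalIntegral.integral_const_mul, intervalIntegral.integral_add (by simp)
      ((hcont.const_mul 2).intervalIntegrable _ _), intervalIntegral.integral_const_mul,
    ← hint.tsum_eq, intervalIntegral.integral_const,
    show c + 1 / 2 - (c - 1 / 2) = 1 by ring, one_smul]
  congr 5
  funext l
  have hl : (0 : ℝ) < l + 1 := by positivity
  rw [intervalIntegral.integral_const_mul, integral_cos_mul_unit_interval (by positivity),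
    _root_.sinc, if_neg (by positivity), hk2, ← mul_assoc (u l)]
  simp only [hu]
  congr 1
  · congr 2
    · congr 2
      field_simp
    · field_simp
  · rw [show 2 * π * (l + 1 : ℝ) / T / 2 = π * ((l + 1) / T) by ring]
end

section
/- Let k ≥ 1 and n ≥ 1 be integers, σ > 0, Δ > 0, and let x, x̂ ∈ ℝⁿ be fixed vectors with ε = ‖x − x̂‖₂ > 0. Let a be a random vector in ℝⁿ with i.i.d. N(0,σ²) entries and let w be uniform on [−1,0), independent of a. Set y = (1/Δ)⟨a,x⟩ + w and ŷ = (1/Δ)⟨a,x̂⟩ + w. Then the pair (D, t) := (y − ŷ, ⌊y + 1/2⌋ − y) has joint law equal to the product of the Gaussian distribution N(0, (σε/Δ)²) and the uniform distribution on (−1/2, 1/2]; in particular D and t are independent, D is Gaussian, and t is uniform on an interval of length 1 centered at 0. -/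
open MeasureTheory ProbabilityTheory Real Set

open scoped NNReal

/-- A finite sum of independent centered Gaussian random variables is a centered Gaussian
random variable whose variance is the sum of the variances. -/
theorem iIndepFun.map_sum_eq_gaussianReal {Ω ι : Type*} [MeasurableSpace Ω] [Fintype ι]
    {P : Measure Ω} {X : ι → Ω → ℝ} {v : ι → ℝ≥0} (hX : ∀ i, Measurable (X i))
    (hindep : iIndepFun X P) (hlaw : ∀ i, P.map (X i) = gaussianReal 0 (v i)) :
    P.map (fun ω => ∑ i, X i ω) = gaussianReal 0 (∑ i, v i) := by
  have := hindep.isProbabilityMeasure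
  apply Measure.ext_of_charFun
  rw [hindep.charFun_map_fun_sum_eq_prod fun i => (hX i).aemeasurable]
  ext t
  simp only [Finset.prod_apply, hlaw, charFun_gaussianReal, ← Complex.exp_sum]
  congr 1
  push_cast
  simp [Finset.sum_mul, Finset.sum_div]

/-- The rounding offset of `z + 1` equals the rounding offset of `z`. -/
theorem periodic_floor_add_half_sub :
    Function.Periodic (fun z : ℝ => (⌊z + 1 / 2⌋ : ℝ) - z) 1 := by
  intro z
  have : z + 1 + 1 / 2 = z + 1 / 2 + 1 := by ring
  simp only [this, Int.floor_add_one]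
  push_cast
  ring

theorem measurable_floor_add_half_sub :
    Measurable (fun z : ℝ => (⌊z + 1 / 2⌋ : ℝ) - z) := by
  fun_prop

/-- If `w` is uniform on `[-1, 0)`, then the rounding offset of `c + w` is uniform on
`(-1/2, 1/2]`. -/
theorem map_floor_add_half_sub_restrict_Ico (c : ℝ) :
    (volume.restrict (Ico (-1 : ℝ) 0)).map (fun w => (⌊c + w + 1 / 2⌋ : ℝ) - (c + w)) =
      volume.restrict (Ioc (-(1 / 2) : ℝ) (1 / 2)) := by
  have hm : Measurable (fun w : ℝ => (⌊c + w + 1 / 2⌋ : ℝ) - (c + w)) :=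
    measurable_floor_add_half_sub.comp (measurable_const_add c)
  have hper : Function.Periodic (fun w : ℝ => (⌊c + w + 1 / 2⌋ : ℝ) - (c + w)) 1 := fun w => by
    simpa only [add_assoc] using periodic_floor_add_half_sub (c + w)
  ext s hs
  rw [Measure.map_apply hm hs, Measure.restrict_apply hs, restrict_Ico_eq_restrict_Ioc,
    Measure.restrict_apply (hm hs)]
  have hshift := (isAddFundamentalDomain_Ioc one_pos (-1 : ℝ)).measure_set_eq
    (isAddFundamentalDomain_Ioc one_pos (-c - 1 / 2)) (hm hs) (fun g => by
      ext w
      simp only [mem_preimage]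
      rw [hper.map_vadd_zmultiples g w])
  rw [neg_add_cancel] at hshift
  rw [hshift]
  have hmp : MeasurePreserving (fun w : ℝ => -c - w) := Measure.measurePreserving_sub_left volume (-c)
  rw [← hmp.measure_preimage (hs.inter measurableSet_Ioc).nullMeasurableSet]
  refine (measure_congr (ae_eq_set_inter Filter.EventuallyEq.rfl Ico_ae_eq_Ioc)).symm.trans ?_
  congr 1
  ext w
  have key : w ∈ Ico (-c - 1 / 2) (-c - 1 / 2 + 1) ↔ -c - w ∈ Ioc (-(1 / 2) : ℝ) (1 / 2) := by
    constructor <;> rintro ⟨h₁, h₂⟩ <;> constructor <;> linarith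
  simp only [mem_inter_iff, mem_preimage, ← key]
  refine and_congr_left fun hw => ?_
  have : ⌊c + w + 1 / 2⌋ = 0 := Int.floor_eq_zero_iff.2 ⟨by linarith [hw.1], by linarith [hw.2]⟩
  rw [this, Int.cast_zero, zero_sub, neg_add']

/-- For dithered Gaussian random projections, the pair `(D, t) = (y − ŷ, ⌊y + 1/2⌋ − y)` of the
signed measurement distance and the quantization offset has joint law equal to the product of
the Gaussian `N(0, (σε/Δ)²)` and the uniform distribution on `(−1/2, 1/2]`; in particular `D`
and `t` are independent, `D` is Gaussian, and `t` is uniform. -/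
theorem signed_distance_offset_joint_law
    {Ω : Type*} [MeasurableSpace Ω] (P : Measure Ω) [IsProbabilityMeasure P]
    (k n : ℕ) (hk : 1 ≤ k) (hn : 1 ≤ n)
    (σ Δ : ℝ) (hσ : 0 < σ) (hΔ : 0 < Δ)
    (x xh : Fin n → ℝ)
    (ε : ℝ) (hε : ε = Real.sqrt (∑ i, (x i - xh i) ^ 2)) (hεpos : 0 < ε)
    (a : Ω → Fin n → ℝ) (w : Ω → ℝ)
    (ha_meas : Measurable a) (hw_meas : Measurable w)
    (ha_indep : iIndepFun (fun (i : Fin n) ω => a ω i) P)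
    (ha_law : ∀ i, Measure.map (fun ω => a ω i) P = gaussianReal 0 ⟨σ ^ 2, sq_nonneg σ⟩)
    (hw_law : Measure.map w P = volume.restrict (Set.Ico (-1 : ℝ) 0))
    (haw_indep : IndepFun a w P)
    (y yh : Ω → ℝ)
    (hy : y = fun ω => (1 / Δ) * (∑ i, a ω i * x i) + w ω)
    (hyh : yh = fun ω => (1 / Δ) * (∑ i, a ω i * xh i) + w ω) :
    Measure.map (fun ω => (y ω - yh ω, (⌊y ω + 1 / 2⌋ : ℝ) - y ω)) P =
      (gaussianReal 0 ⟨(σ * ε / Δ) ^ 2, sq_nonneg _⟩).prod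
        (volume.restrict (Set.Ioc (-(1 / 2) : ℝ) (1 / 2))) := by
  have hD : P.map (fun ω => ∑ i, (x i - xh i) / Δ * a ω i) =
      gaussianReal 0 ⟨(σ * ε / Δ) ^ 2, sq_nonneg _⟩ := by
    have hsum := iIndepFun.map_sum_eq_gaussianReal
      (X := fun i ω => (x i - xh i) / Δ * a ω i)
      (fun i => ((measurable_pi_apply i).comp ha_meas).const_mul _)
      (ha_indep.comp (fun i t => (x i - xh i) / Δ * t) fun i => measurable_const_mul _)
      (fun i => by
        simpa using (gaussianReal_const_mul (X := fun ω => a ω i)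
          ⟨((measurable_pi_apply i).comp ha_meas).aemeasurable, ha_law i⟩
          ((x i - xh i) / Δ)).map_eq)
    rw [hsum]
    congr 1
    ext
    have hεsq : ε ^ 2 = ∑ i, (x i - xh i) ^ 2 := by
      rw [hε, Real.sq_sqrt (Finset.sum_nonneg fun i _ => sq_nonneg _)]
    rw [NNReal.coe_sum]
    change ∑ i, ((x i - xh i) / Δ) ^ 2 * σ ^ 2 = (σ * ε / Δ) ^ 2
    rw [div_pow, mul_pow, hεsq, Finset.mul_sum, Finset.sum_div]
    exact Finset.sum_congr rfl fun i _ => by ring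
  have hpair : P.map (fun ω => (a ω, w ω)) =
      (P.map a).prod (volume.restrict (Ico (-1 : ℝ) 0)) := by
    rw [haw_indep.map_prod_eq_prod_map_map ha_meas.aemeasurable hw_meas.aemeasurable, hw_law]
  have hf : Measurable fun v : Fin n → ℝ => ∑ i, (x i - xh i) / Δ * v i := by fun_prop
  have hg : Measurable (Function.uncurry fun (v : Fin n → ℝ) (u : ℝ) =>
      (⌊1 / Δ * (∑ i, v i * x i) + u + 1 / 2⌋ : ℝ) - (1 / Δ * (∑ i, v i * x i) + u)) :=
    measurable_floor_add_half_sub.comp (g := fun z : ℝ => (⌊z + 1 / 2⌋ : ℝ) - z)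
      (f := fun p : (Fin n → ℝ) × ℝ => 1 / Δ * (∑ i, p.1 i * x i) + p.2) (by fun_prop)
  have : IsProbabilityMeasure (P.map a) := Measure.isProbabilityMeasure_map ha_meas.aemeasurable
  have hmp := MeasurePreserving.skew_product (μa := P.map a)
    (⟨hf, by rw [Measure.map_map hf ha_meas]; exact hD⟩ :
      MeasurePreserving _ _ (gaussianReal 0 ⟨(σ * ε / Δ) ^ 2, sq_nonneg _⟩))
    hg (.of_forall fun v => map_floor_add_half_sub_restrict_Ico _)
  rw [← hmp.map_eq, ← hpair, Measure.map_map hmp.measurable (ha_meas.prodMk hw_meas)]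
  congr 1
  funext ω
  subst hy hyh
  simp only [Function.comp_apply, Prod.mk.injEq, and_true, add_sub_add_right_eq_sub,
    Finset.mul_sum, ← Finset.sum_sub_distrib]
  exact Finset.sum_congr rfl fun i _ => by ring
end

section
/- For every integer k ≥ 1 and every s > 0, the series value Σ_{l=1}^{∞} exp(−(1/2)(πsl/2^{k−1})²) · sinc(l/2^k) · sinc(l/2) lies in the closed interval [0, 1/2]; equivalently, the bit error probability p_k = 1/2 − Σ_{l=1}^{∞} exp(−(1/2)(πsl/2^{k−1})²) · sinc(l/2^k) · sinc(l/2) satisfies 0 ≤ p_k ≤ 1/2. -/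
open Real

open Filter Topology

/-- The odd cosine series `∑ₘ bₘ cos ((2m+1) x)`. -/
noncomputable def oddCosSeries (b : ℕ → ℝ) (x : ℝ) : ℝ :=
  ∑' m : ℕ, b m * Real.cos ((2 * m + 1) * x)

/-- `V` is antitone on `[0, π]` and falls at rate at most `C` there. -/
def DecreasesAtRateLE (C : ℝ) (V : ℝ → ℝ) : Prop :=
  ∀ x y : ℝ, 0 ≤ x → x ≤ y → y ≤ π → 0 ≤ V x - V y ∧ V x - V y ≤ C * (y - x)

lemma DecreasesAtRateLE.of_tendsto {C : ℝ} {V : ℝ → ℝ} {W : ℕ → ℝ → ℝ}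
    (hW : ∀ᶠ n in atTop, DecreasesAtRateLE C (W n))
    (hlim : ∀ x, Tendsto (fun n => W n x) atTop (𝓝 (V x))) : DecreasesAtRateLE C V := by
  intro x y hx hxy hy
  have h := (hlim x).sub (hlim y)
  exact ⟨ge_of_tendsto h (hW.mono fun n hn => (hn x y hx hxy hy).1),
    le_of_tendsto h (hW.mono fun n hn => (hn x y hx hxy hy).2)⟩

/-- For an even `2π`-periodic function, points closer to `0` on the circle give larger values. -/
lemma DecreasesAtRateLE.sub_add_bounds {C : ℝ} {V : ℝ → ℝ} (hC : 0 ≤ C)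
    (hV : DecreasesAtRateLE C V)
    (heven : ∀ x, V (-x) = V x) (hper : ∀ x, V (2 * π - x) = V x) {z r : ℝ}
    (hz0 : 0 ≤ z) (hzπ : z ≤ π) (hr0 : 0 ≤ r) (hrπ : r ≤ π) :
    0 ≤ V (z - r) - V (z + r) ∧ V (z - r) - V (z + r) ≤ C * (2 * r) := by
  obtain ⟨d, hd, hd0, hd1, hd2, hd3⟩ :
      ∃ d, V (z - r) = V d ∧ 0 ≤ d ∧ d ≤ z + r ∧ d ≤ 2 * π - z - r ∧ z + r - d ≤ 2 * r := by
    rcases le_total r z with h | h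
    · exact ⟨z - r, rfl, by linarith, by linarith, by linarith, by linarith⟩
    · exact ⟨r - z, by rw [← heven, neg_sub], by linarith, by linarith, by linarith, by linarith⟩
  obtain ⟨e, he, hde, heπ, hed⟩ :
      ∃ e, V (z + r) = V e ∧ d ≤ e ∧ e ≤ π ∧ e ≤ z + r := by
    rcases le_total (z + r) π with h | h
    · exact ⟨z + r, rfl, hd1, h, le_rfl⟩
    · exact ⟨2 * π - (z + r), (hper _).symm, by linarith, by linarith, by linarith⟩
  rw [hd, he]
  obtain ⟨h1, h2⟩ := hV d e hd0 hde heπ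
  exact ⟨h1, h2.trans (mul_le_mul_of_nonneg_left (by linarith) hC)⟩

lemma summable_oddCosSeries {b : ℕ → ℝ} (hb : Summable fun m => |b m|) (x : ℝ) :
    Summable fun m : ℕ => b m * Real.cos ((2 * m + 1) * x) := by
  refine Summable.of_norm_bounded hb fun m => ?_
  rw [Real.norm_eq_abs, abs_mul]
  exact mul_le_of_le_one_right (abs_nonneg _) (Real.abs_cos_le_one _)

lemma continuous_oddCosSeries {b : ℕ → ℝ} (hb : Summable fun m => |b m|) :
    Continuous (oddCosSeries b) := by
  refine continuous_tsum (fun m => by fun_prop) hb fun m x => ?_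
  rw [Real.norm_eq_abs, abs_mul]
  exact mul_le_of_le_one_right (abs_nonneg _) (Real.abs_cos_le_one _)

lemma oddCosSeries_neg (b : ℕ → ℝ) (x : ℝ) : oddCosSeries b (-x) = oddCosSeries b x := by
  simp [oddCosSeries]

lemma oddCosSeries_two_pi_sub (b : ℕ → ℝ) (x : ℝ) :
    oddCosSeries b (2 * π - x) = oddCosSeries b x := by
  refine tsum_congr fun m => ?_
  have h : (2 * m + 1 : ℝ) * (2 * π - x) = ((2 * m + 1 : ℕ) : ℝ) * (2 * π) - (2 * m + 1) * x := by
    push_cast; ring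
  rw [h, Real.cos_nat_mul_two_pi_sub]

/-- Differences of a moving average of a cosine series, as integrals of the series. -/
lemma integral_oddCosSeries_sub {b : ℕ → ℝ} (hb : Summable fun m => |b m|) {r : ℝ} (hr : 0 < r)
    (x y : ℝ) :
    ∫ z in x..y, (oddCosSeries b (z - r) - oddCosSeries b (z + r)) =
      2 * r * (oddCosSeries (fun m => b m * Real.sinc ((2 * m + 1) * r)) x -
        oddCosSeries (fun m => b m * Real.sinc ((2 * m + 1) * r)) y) := by
  have hb' : Summable fun m : ℕ => |b m * Real.sinc ((2 * m + 1) * r)| := by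
    refine Summable.of_nonneg_of_le (fun _ => abs_nonneg _) (fun m => ?_) hb
    rw [abs_mul]
    exact mul_le_of_le_one_right (abs_nonneg _) (Real.abs_sinc_le_one _)
  let f : ℕ → C(ℝ, ℝ) := fun m =>
    ⟨fun z => b m * (2 * Real.sin ((2 * m + 1) * r) * Real.sin ((2 * m + 1) * z)), by fun_prop⟩
  have hf : ∀ (m : ℕ) (z : ℝ), f m z =
      b m * Real.cos ((2 * m + 1) * (z - r)) - b m * Real.cos ((2 * m + 1) * (z + r)) := by
    intro m z
    simp only [f, ContinuousMap.coe_mk]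
    rw [mul_sub, mul_add, Real.cos_sub, Real.cos_add]
    ring
  have hsum : Summable fun m =>
      ‖(f m).restrict (⟨Set.uIcc x y, isCompact_uIcc⟩ : TopologicalSpace.Compacts ℝ)‖ := by
    refine Summable.of_nonneg_of_le (fun _ => norm_nonneg _) (fun m => ?_) (hb.mul_left 2)
    rw [ContinuousMap.norm_le _ (by positivity)]
    intro z
    simp only [f, ContinuousMap.restrict_apply, ContinuousMap.coe_mk, Real.norm_eq_abs, abs_mul,
      abs_two]
    have h1 := Real.abs_sin_le_one ((2 * m + 1) * r)
    have h2 := Real.abs_sin_le_one ((2 * m + 1) * z)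
    have h3 := mul_le_one₀ h1 (abs_nonneg _) h2
    have := mul_le_mul_of_nonneg_left h3 (abs_nonneg (b m))
    linarith
  have key := intervalIntegral.hasSum_intervalIntegral_of_summable_norm hsum
  have hfz : ∀ z, ∑' m, f m z = oddCosSeries b (z - r) - oddCosSeries b (z + r) := by
    intro z
    simp_rw [hf]
    exact (summable_oddCosSeries hb _).tsum_sub (summable_oddCosSeries hb _)
  simp_rw [hfz] at key
  rw [← key.tsum_eq, oddCosSeries, oddCosSeries,
    ← (summable_oddCosSeries hb' x).tsum_sub (summable_oddCosSeries hb' y), ← tsum_mul_left]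
  refine tsum_congr fun m => ?_
  have hL : (2 * m + 1 : ℝ) ≠ 0 := by positivity
  simp only [f, ContinuousMap.coe_mk]
  rw [intervalIntegral.integral_const_mul, intervalIntegral.integral_const_mul,
    intervalIntegral.integral_comp_mul_left (fun z => Real.sin z) hL, integral_sin,
    Real.sinc_of_ne_zero (by positivity), smul_eq_mul]
  field_simp

lemma DecreasesAtRateLE.mul_sinc {C : ℝ} (hC : 0 ≤ C) {b : ℕ → ℝ}
    (hb : Summable fun m => |b m|) (hV : DecreasesAtRateLE C (oddCosSeries b)) {r : ℝ}
    (hr : 0 < r) (hrπ : r ≤ π) :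
    DecreasesAtRateLE C (oddCosSeries fun m => b m * Real.sinc ((2 * m + 1) * r)) := by
  intro x y hx hxy hy
  have hcont := continuous_oddCosSeries hb
  have hint : IntervalIntegrable (fun z => oddCosSeries b (z - r) - oddCosSeries b (z + r))
      MeasureTheory.volume x y := by
    apply Continuous.intervalIntegrable
    fun_prop
  have hbd : ∀ z ∈ Set.Icc x y, 0 ≤ oddCosSeries b (z - r) - oddCosSeries b (z + r) ∧
      oddCosSeries b (z - r) - oddCosSeries b (z + r) ≤ C * (2 * r) := fun z hz =>
    hV.sub_add_bounds hC (oddCosSeries_neg b) (oddCosSeries_two_pi_sub b)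
      (hx.trans hz.1) (hz.2.trans hy) hr.le hrπ
  have h0 := intervalIntegral.integral_nonneg (μ := MeasureTheory.volume) hxy
    fun z hz => (hbd z hz).1
  have h1 := intervalIntegral.integral_mono_on hxy hint (intervalIntegrable_const)
    fun z hz => (hbd z hz).2
  rw [intervalIntegral.integral_const, smul_eq_mul, integral_oddCosSeries_sub hb hr] at h1
  rw [integral_oddCosSeries_sub hb hr] at h0
  constructor
  · exact nonneg_of_mul_nonneg_right h0 (by positivity)
  · refine le_of_mul_le_mul_left (a := 2 * r) ?_ (by positivity)
    linarith

lemma summable_one_div_odd_sq : Summable fun m : ℕ => 1 / (2 * m + 1 : ℝ) ^ 2 := by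
  have h := (Real.summable_one_div_nat_pow.mpr one_lt_two).comp_injective
    (i := fun m : ℕ => 2 * m + 1) fun a b h => by simpa using h
  simpa [Function.comp_def] using h

lemma summable_abs_one_div_odd_sq_mul_sinc_pow (r : ℝ) (n : ℕ) :
    Summable fun m : ℕ => |1 / (2 * m + 1 : ℝ) ^ 2 * Real.sinc ((2 * m + 1) * r) ^ n| := by
  refine Summable.of_nonneg_of_le (fun _ => abs_nonneg _) (fun m => ?_) summable_one_div_odd_sq
  rw [abs_mul, abs_pow, abs_of_nonneg (by positivity)]
  exact mul_le_of_le_one_right (by positivity)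
    (pow_le_one₀ (abs_nonneg _) (Real.abs_sinc_le_one _))

/-- The triangle wave. -/
lemma oddCosSeries_one_div_sq {x : ℝ} (hx0 : 0 ≤ x) (hxπ : x ≤ π) :
    oddCosSeries (fun m => 1 / (2 * m + 1 : ℝ) ^ 2) x = π ^ 2 / 8 - π / 4 * x := by
  have hπ := Real.pi_pos
  have bern : ∀ t : ℝ, t ∈ Set.Icc (0 : ℝ) 1 →
      HasSum (fun n : ℕ => 1 / (n : ℝ) ^ 2 * Real.cos (2 * π * n * t))
        (π ^ 2 * (t ^ 2 - t + 1 / 6)) := by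
    intro t ht
    convert hasSum_one_div_nat_pow_mul_cos one_ne_zero ht using 1
    · simp only [mul_one]
    rw [mul_one, Polynomial.eval_map, Polynomial.bernoulli]
    simp [Finset.sum_range_succ, bernoulli_two, _root_.bernoulli_one]
    ring
  have hall := bern (x / (2 * π)) ⟨by positivity, by rw [div_le_one (by positivity)]; linarith⟩
  have heven := (bern (x / π) ⟨by positivity, by rwa [div_le_one hπ]⟩).mul_left (1 / 4)
  have h := summable_oddCosSeries (b := fun m => 1 / (2 * m + 1 : ℝ) ^ 2)
    summable_one_div_odd_sq.abs x
  have hsplit := HasSum.even_add_odd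
    (f := fun n : ℕ => 1 / (n : ℝ) ^ 2 * Real.cos (2 * π * n * (x / (2 * π))))
    (m := 1 / 4 * (π ^ 2 * ((x / π) ^ 2 - x / π + 1 / 6)))
    (m' := oddCosSeries (fun m => 1 / (2 * m + 1 : ℝ) ^ 2) x) ?_ ?_
  · have := hsplit.unique hall
    field_simp at this ⊢
    linarith
  · refine Eq.mpr (congrArg (HasSum · _ _) (funext fun n => ?_)) heven
    push_cast
    rw [show 2 * π * (2 * n) * (x / (2 * π)) = 2 * π * n * (x / π) by field_simp]
    ring
  · refine Eq.mpr (congrArg (HasSum · _ _) (funext fun n => ?_)) h.hasSum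
    push_cast
    rw [show 2 * π * (2 * n + 1) * (x / (2 * π)) = (2 * n + 1) * x by field_simp]

lemma decreasesAtRateLE_sinc_pow {r : ℝ} (hr : 0 < r) (hrπ : r ≤ π) (n : ℕ) :
    DecreasesAtRateLE (π / 4) (oddCosSeries fun m =>
      1 / (2 * m + 1 : ℝ) ^ 2 * Real.sinc ((2 * m + 1) * r) ^ n) := by
  induction n with
  | zero =>
    intro x y hx hxy hy
    simp only [pow_zero, mul_one]
    rw [oddCosSeries_one_div_sq hx (hxy.trans hy), oddCosSeries_one_div_sq (hx.trans hxy) hy]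
    have := mul_le_mul_of_nonneg_left hxy (show 0 ≤ π / 4 by positivity)
    constructor <;> linarith
  | succ n ih =>
    simp only [pow_succ, ← mul_assoc]
    exact ih.mul_sinc (by positivity) (summable_abs_one_div_odd_sq_mul_sinc_pow r n) hr hrπ

lemma abs_sinc_sub_le {x : ℝ} (hx : |x| ≤ 1) :
    |Real.sinc x - 1 + x ^ 2 / 6| ≤ |x| ^ 4 / 100 := by
  rcases eq_or_ne x 0 with rfl | h0
  · simp
  have h := Real.sin_bound hx
  have hpos := abs_pos.mpr h0
  rw [Real.sinc_of_ne_zero h0]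
  have e : Real.sin x - (x - x ^ 3 / 6) = x * (Real.sin x / x - 1 + x ^ 2 / 6) := by
    field_simp
    ring
  rw [e, abs_mul] at h
  refine le_of_mul_le_mul_left (h.trans_eq ?_) hpos
  ring

lemma tendsto_sinc_div_sqrt_pow (x : ℝ) :
    Tendsto (fun n : ℕ => Real.sinc (x / √n) ^ n) atTop (𝓝 (Real.exp (-x ^ 2 / 6))) := by
  have hg : Tendsto (fun n : ℕ => (n : ℝ) * (Real.sinc (x / √n) - 1)) atTop
      (𝓝 (-x ^ 2 / 6)) := by
    rw [tendsto_iff_dist_tendsto_zero]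
    have hz : Tendsto (fun n : ℕ => x ^ 4 / 100 / (n : ℝ)) atTop (𝓝 0) :=
      tendsto_const_div_atTop_nhds_zero_nat _
    have hs : Tendsto (fun n : ℕ => |x / √n|) atTop (𝓝 0) := by
      have := (tendsto_const_nhds (x := x)).div_atTop
        (Real.tendsto_sqrt_atTop.comp tendsto_natCast_atTop_atTop)
      simpa using this.abs
    refine squeeze_zero' (Eventually.of_forall fun _ => dist_nonneg) ?_ hz
    filter_upwards [hs.eventually_le_const one_pos, eventually_gt_atTop 0] with n hn hn0
    have hn' : (0 : ℝ) < n := by exact_mod_cast hn0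
    have hsq : √(n : ℝ) ^ 2 = n := Real.sq_sqrt hn'.le
    have hb := abs_sinc_sub_le hn
    have e : (n : ℝ) * (Real.sinc (x / √n) - 1) - -x ^ 2 / 6 =
        n * (Real.sinc (x / √n) - 1 + (x / √n) ^ 2 / 6) := by
      rw [div_pow, hsq]
      field_simp
      ring
    rw [Real.dist_eq, e, abs_mul, abs_of_pos hn']
    refine (mul_le_mul_of_nonneg_left hb hn'.le).trans_eq ?_
    rw [show |x / √(n : ℝ)| ^ 4 = ((x / √(n : ℝ)) ^ 2) ^ 2 by
      rw [← sq_abs (x / √(n : ℝ))]; ring, div_pow, hsq]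
    field_simp
  simpa using Real.tendsto_one_add_pow_exp_of_tendsto hg

/-- The heat flow of the triangle wave stays antitone on `[0, π]` and `π / 4`-Lipschitz. -/
lemma decreasesAtRateLE_exp {c : ℝ} (hc : 0 < c) :
    DecreasesAtRateLE (π / 4) (oddCosSeries fun m =>
      1 / (2 * m + 1 : ℝ) ^ 2 * Real.exp (-((2 * m + 1) * c) ^ 2 / 6)) := by
  have hr : Tendsto (fun n : ℕ => c / √n) atTop (𝓝 0) :=
    (tendsto_const_nhds (x := c)).div_atTop
      (Real.tendsto_sqrt_atTop.comp tendsto_natCast_atTop_atTop)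
  refine DecreasesAtRateLE.of_tendsto (W := fun n => oddCosSeries fun m =>
      1 / (2 * m + 1 : ℝ) ^ 2 * Real.sinc ((2 * m + 1) * (c / √n)) ^ n) ?_ fun x => ?_
  · filter_upwards [hr.eventually_le_const Real.pi_pos, eventually_gt_atTop 0] with n hn hn0
    have hn' : (0 : ℝ) < n := by exact_mod_cast hn0
    exact decreasesAtRateLE_sinc_pow (by positivity) hn n
  · refine tendsto_tsum_of_dominated_convergence summable_one_div_odd_sq (fun m => ?_)
      (Eventually.of_forall fun n m => ?_)
    · simp_rw [← mul_div_assoc]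
      exact ((tendsto_sinc_div_sqrt_pow _).const_mul _).mul_const _
    · rw [Real.norm_eq_abs, abs_mul, abs_mul, abs_pow, abs_of_nonneg (by positivity), mul_assoc]
      exact mul_le_of_le_one_right (by positivity)
        (mul_le_one₀ (pow_le_one₀ (abs_nonneg _) (Real.abs_sinc_le_one _)) (abs_nonneg _)
          (Real.abs_cos_le_one _))

/-- The series `Σ_{l≥1} exp(−(1/2)(πsl/2^{k−1})²) sinc(l/2^k) sinc(l/2)` lies in `[0, 1/2]`;
equivalently, the bit error probability `p_k = 1/2 −` (this series) satisfies `0 ≤ p_k ≤ 1/2`. -/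
theorem bit_error_series_mem_Icc (k : ℕ) (hk : 1 ≤ k) (s : ℝ) (hs : 0 < s) :
    (∑' l : ℕ, Real.exp (-(1 / 2) * (Real.pi * s * (l + 1) / 2 ^ (k - 1)) ^ 2) *
        _root_.sinc ((l + 1) / 2 ^ k) * _root_.sinc ((l + 1) / 2)) ∈ Set.Icc (0 : ℝ) (1 / 2) := by
  have hπ := Real.pi_pos
  obtain ⟨N, hN⟩ : ∃ N : ℝ, N = 2 ^ k := ⟨_, rfl⟩
  have hN2 : 2 ≤ N := hN ▸ le_self_pow₀ one_le_two (by omega)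
  have hN0 : 0 < N := by linarith
  obtain ⟨c, hcdef⟩ : ∃ c : ℝ, c = √3 * (π * s / 2 ^ (k - 1)) := ⟨_, rfl⟩
  have hc : 0 < c := hcdef ▸ by positivity
  have hδ : π / N ≤ π / 2 := by gcongr
  have hδ0 : 0 < π / N := by positivity
  obtain ⟨b, hbdef⟩ : ∃ b : ℕ → ℝ, b = fun m : ℕ =>
      1 / (2 * m + 1 : ℝ) ^ 2 * Real.exp (-((2 * m + 1) * c) ^ 2 / 6) := ⟨_, rfl⟩
  have hb : Summable fun m => |b m| := by
    refine Summable.of_nonneg_of_le (fun _ => abs_nonneg _) (fun m => ?_) summable_one_div_odd_sq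
    rw [hbdef, abs_of_nonneg (by positivity)]
    refine mul_le_of_le_one_right (by positivity) (Real.exp_le_one_iff.mpr ?_)
    have : 0 ≤ ((2 * m + 1) * c) ^ 2 := by positivity
    linarith
  have hV := decreasesAtRateLE_exp hc (π / 2 - π / N) (π / 2 + π / N) (by linarith)
    (by linarith) (by linarith)
  rw [← hbdef] at hV
  have hseries : (∑' l : ℕ, Real.exp (-(1 / 2) * (Real.pi * s * (l + 1) / 2 ^ (k - 1)) ^ 2) *
        _root_.sinc ((l + 1) / 2 ^ k) * _root_.sinc ((l + 1) / 2)) =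
      N / π ^ 2 * (oddCosSeries b (π / 2 - π / N) - oddCosSeries b (π / 2 + π / N)) := by
    rw [oddCosSeries, oddCosSeries,
      ← (summable_oddCosSeries hb _).tsum_sub (summable_oddCosSeries hb _), ← tsum_mul_left,
      ← (mul_right_injective₀ (two_ne_zero' ℕ)).tsum_eq]
    · refine tsum_congr fun m => ?_
      have hL : (0 : ℝ) < 2 * m + 1 := by positivity
      have he : -(1 / 2) * (π * s * (2 * m + 1) / 2 ^ (k - 1)) ^ 2 =
          -((2 * m + 1) * c) ^ 2 / 6 := by
        rw [hcdef, mul_pow, mul_pow √3, Real.sq_sqrt (by norm_num)]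
        ring
      push_cast
      rw [he, ← hN, hbdef, _root_.sinc, _root_.sinc, if_neg (by positivity), if_neg (by positivity),
        mul_sub (2 * (m : ℝ) + 1), mul_add (2 * (m : ℝ) + 1), Real.cos_sub, Real.cos_add,
        show π * ((2 * m + 1) / N) = (2 * m + 1) * (π / N) by ring,
        show π * ((2 * m + 1) / 2) = (2 * m + 1) * (π / 2) by ring]
      field_simp
      ring
    · intro l hl
      by_contra hodd
      have hodd' : Odd l := by
        rw [← Nat.not_even_iff_odd]
        rintro ⟨j, rfl⟩
        exact hodd ⟨j, by simp [two_mul]⟩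
      obtain ⟨j, rfl⟩ := hodd'
      refine hl ?_
      have : _root_.sinc (((2 * j + 1 : ℕ) + 1 : ℝ) / 2) = 0 := by
        rw [_root_.sinc, if_neg (by positivity),
          show π * (((2 * j + 1 : ℕ) + 1 : ℝ) / 2) = ((j + 1 : ℕ) : ℝ) * π by push_cast; ring,
          Real.sin_nat_mul_pi, zero_div]
      simp only [this, mul_zero]
  rw [hseries]
  refine ⟨mul_nonneg (by positivity) hV.1,
    (mul_le_mul_of_nonneg_left hV.2 (by positivity)).trans_eq ?_⟩
  field_simp
  ring
end
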